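/- arXiv:1704.01368 — 2 statements merged into one kernel-verified Lean document; each statement's English description precedes it below -/
import Mathlib

section
/- Fix real parameters ω > 0, χ > 0, ζ > 0, C > 0 and set γ = ωχ, μ = γC. Define F₂(P) = −χP² + γP + μ − ζP²e^{ω/P} for P > 0, and let β > 0 be the unique zero of F₂′(P) = −2χP + γ + ζ e^{ω/P}(ω − 2P). Then F₂ is strictly increasing on (0, β] and strictly decreasing on [β, ∞). -/
/-- The auxiliary function `F₂(P) = -χ P² + γ P + μ - ζ P² e^{ω/P}`. -/
noncomputable def F2 (ω χ γ μ ζ : ℝ) (P : ℝ) : ℝ :=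
  -χ * P ^ 2 + γ * P + μ - ζ * P ^ 2 * Real.exp (ω / P)

/-- `F₂'(P) = -2χP + γ + ζ e^{ω/P} (ω - 2P)`. -/
noncomputable def F2deriv (ω χ γ ζ : ℝ) (P : ℝ) : ℝ :=
  -2 * χ * P + γ + ζ * Real.exp (ω / P) * (ω - 2 * P)

lemma F2deriv_eq_mul (ω χ ζ P : ℝ) :
    F2deriv ω χ (ω * χ) ζ P = (ω - 2 * P) * (χ + ζ * Real.exp (ω / P)) := by
  unfold F2deriv
  ring

lemma hasDerivAt_F2 (ω χ γ μ ζ : ℝ) {P : ℝ} (hP : P ≠ 0) :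
    HasDerivAt (F2 ω χ γ μ ζ) (F2deriv ω χ γ ζ P) P := by
  have hdiv : HasDerivAt (fun x : ℝ => ω / x) (-ω / P ^ 2) P := by
    simpa using (hasDerivAt_const P ω).fun_div (hasDerivAt_id' P) hP
  have hsq : HasDerivAt (fun x : ℝ => x ^ 2) (2 * P) P := by
    simpa using hasDerivAt_pow 2 P
  have h := ((((hsq.const_mul (-χ)).fun_add ((hasDerivAt_id' P).const_mul γ)).add_const μ).fun_sub
    ((hsq.const_mul ζ).fun_mul hdiv.exp))
  refine h.congr_deriv ?_
  unfold F2deriv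
  field_simp
  ring

/-- If `β > 0` is the unique zero of `F₂'`, then `F₂` is strictly increasing on `(0, β]`
and strictly decreasing on `[β, ∞)`. -/
theorem F2_monotone (ω χ ζ C γ μ : ℝ)
    (hω : 0 < ω) (hχ : 0 < χ) (hζ : 0 < ζ) (hC : 0 < C)
    (hγ : γ = ω * χ) (hμ : μ = γ * C)
    (β : ℝ) (hβ : 0 < β) (hβ0 : F2deriv ω χ γ ζ β = 0)
    (hβuniq : ∀ x : ℝ, 0 < x → F2deriv ω χ γ ζ x = 0 → x = β) :
    StrictMonoOn (F2 ω χ γ μ ζ) (Set.Ioc 0 β) ∧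
    StrictAntiOn (F2 ω χ γ μ ζ) (Set.Ici β) := by
  subst hγ
  have hfac (P : ℝ) : 0 < χ + ζ * Real.exp (ω / P) := by positivity
  have hβω : ω - 2 * β = 0 := by
    rw [F2deriv_eq_mul] at hβ0
    exact (mul_eq_zero.mp hβ0).resolve_right (hfac β).ne'
  constructor
  · refine strictMonoOn_of_deriv_pos (convex_Ioc 0 β)
      (fun x hx => (hasDerivAt_F2 _ _ _ _ _ hx.1.ne').continuousAt.continuousWithinAt) ?_
    intro x hx
    rw [interior_Ioc] at hx
    rw [(hasDerivAt_F2 _ _ _ _ _ hx.1.ne').deriv, F2deriv_eq_mul]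
    exact mul_pos (by linarith [hx.2]) (hfac x)
  · refine strictAntiOn_of_deriv_neg (convex_Ici β)
      (fun x hx => (hasDerivAt_F2 _ _ _ _ _
        (hβ.trans_le hx).ne').continuousAt.continuousWithinAt) ?_
    intro x hx
    rw [interior_Ici, Set.mem_Ioi] at hx
    rw [(hasDerivAt_F2 _ _ _ _ _ (hβ.trans hx).ne').deriv, F2deriv_eq_mul]
    exact mul_neg_of_neg_of_pos (by linarith) (hfac x)
end

section
/- Fix real parameters ω > 0, χ > 0, ζ > 0, C > 0 and set γ = ωχ, μ = γC. Define η(P) = (χ e^{−ω/P} + ζ)/(P + C) and F₂(P) = −χP² + γP + μ − ζP²e^{ω/P} for P > 0. If F₂(β) > 0, where β is the unique zero of F₂′(P) = −2χP + γ + ζ e^{ω/P}(ω − 2P), then η is not quasi-concave on (0, ∞): there exist 0 < a < b < c such that η(b) < min(η(a), η(c)). -/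
/-- Energy efficiency of one multicast group as a function of its transmit power `P`:
`η(P) = (χ e^{-ω/P} + ζ)/(P + C)`. -/
noncomputable def eta (ω χ ζ C : ℝ) (P : ℝ) : ℝ :=
  (χ * Real.exp (-ω / P) + ζ) / (P + C)

open Filter Topology in
/-- A function with negative derivative at `p` takes smaller values just to the right of `p`. -/
theorem HasDerivAt.eventually_lt_right {f : ℝ → ℝ} {f' p : ℝ} (h : HasDerivAt f f' p)
    (hf' : f' < 0) : ∀ᶠ x in 𝓝[>] p, f x < f p := by
  have hs := (hasDerivAt_iff_tendsto_slope.1 h).eventually_lt_const hf'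
  filter_upwards [nhdsWithin_mono p (fun x (hx : p < x) => hx.ne') hs, self_mem_nhdsWithin]
    with x hx hpx
  rw [slope_def_field, div_neg_iff] at hx
  have hpx : p < x := hpx
  rcases hx with hx | hx <;> linarith [hx.1, hx.2]

open Filter Topology in
/-- A function with positive derivative at `p` takes smaller values just to the left of `p`. -/
theorem HasDerivAt.eventually_lt_left {f : ℝ → ℝ} {f' p : ℝ} (h : HasDerivAt f f' p)
    (hf' : 0 < f') : ∀ᶠ x in 𝓝[<] p, f x < f p := by
  have hs := (hasDerivAt_iff_tendsto_slope.1 h).eventually_const_lt hf'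
  filter_upwards [nhdsWithin_mono p (fun x (hx : x < p) => hx.ne) hs, self_mem_nhdsWithin]
    with x hx hpx
  rw [slope_def_field, div_pos_iff] at hx
  have hpx : x < p := hpx
  rcases hx with hx | hx <;> linarith [hx.1, hx.2]

/-- The derivative of `eta` is a positive multiple of `F2`. -/
theorem hasDerivAt_eta (ω χ ζ : ℝ) {C P : ℝ} (hC : 0 < C) (hP : 0 < P) :
    HasDerivAt (eta ω χ ζ C)
      (Real.exp (-ω / P) / (P ^ 2 * (P + C) ^ 2) * F2 ω χ (ω * χ) (ω * χ * C) ζ P) P := by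
  have hPC : P + C ≠ 0 := by positivity
  have h1 : HasDerivAt (fun x : ℝ => -ω / x) (ω / P ^ 2) P := by
    convert! (hasDerivAt_inv hP.ne').const_mul (-ω) using 1
    field_simp
  have h2 := ((h1.exp.const_mul χ).add_const ζ).div ((hasDerivAt_id P).add_const C) hPC
  convert! h2 using 1
  simp only [F2, id]
  field_simp
  have hexp : Real.exp (-(ω / P)) * Real.exp (ω / P) = 1 := by
    rw [← Real.exp_add, neg_add_cancel, Real.exp_zero]
  linear_combination (-ζ * P ^ 2) * hexp

/-- `F2` is negative at arbitrarily small transmit powers. -/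
theorem exists_F2_neg {ω χ γ μ ζ β : ℝ} (hω : 0 < ω) (hχ : 0 < χ) (hζ : 0 < ζ) (hγ : 0 < γ)
    (hμ : 0 < μ) (hβ : 0 < β) : ∃ P, 0 < P ∧ P < β ∧ F2 ω χ γ μ ζ P < 0 := by
  obtain ⟨P, hP, hPlt⟩ := exists_between
    (show (0 : ℝ) < min β (min 1 (ζ * ω ^ 3 / 6 / (γ + μ))) by positivity)
  obtain ⟨hPβ, hP1, hPb⟩ : P < β ∧ P < 1 ∧ P < ζ * ω ^ 3 / 6 / (γ + μ) := by
    simpa only [lt_min_iff] using hPlt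
  refine ⟨P, hP, hPβ, ?_⟩
  have hexp : (ω / P) ^ 3 / 6 ≤ Real.exp (ω / P) := by
    simpa [Nat.factorial] using Real.pow_div_factorial_le_exp (ω / P) (by positivity) 3
  have hmul : ζ * ω ^ 3 / 6 / P ≤ ζ * P ^ 2 * Real.exp (ω / P) := by
    calc ζ * ω ^ 3 / 6 / P = ζ * P ^ 2 * ((ω / P) ^ 3 / 6) := by field_simp
      _ ≤ _ := by gcongr
  have hbig : γ + μ < ζ * ω ^ 3 / 6 / P := by
    rw [lt_div_iff₀ (by positivity)] at hPb ⊢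
    linarith
  have hγP : γ * P < γ := mul_lt_of_lt_one_right hγ hP1
  have hχP : 0 < χ * P ^ 2 := by positivity
  unfold F2
  linarith

/-- If `F₂(β) > 0`, where `β` is the unique zero of `F₂'`, then `η` is not quasi-concave
on `(0, ∞)`: there exist `0 < a < b < c` with `η(b) < min (η(a)) (η(c))`. -/
theorem eta_not_quasiconcave (ω χ ζ C γ μ : ℝ)
    (hω : 0 < ω) (hχ : 0 < χ) (hζ : 0 < ζ) (hC : 0 < C)
    (hγ : γ = ω * χ) (hμ : μ = γ * C)
    (β : ℝ) (hβ : 0 < β) (hβ0 : F2deriv ω χ γ ζ β = 0)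
    (hβuniq : ∀ x : ℝ, 0 < x → F2deriv ω χ γ ζ x = 0 → x = β)
    (hpos : 0 < F2 ω χ γ μ ζ β) :
    ∃ a b c : ℝ, 0 < a ∧ a < b ∧ b < c ∧
      eta ω χ ζ C b < min (eta ω χ ζ C a) (eta ω χ ζ C c) := by
  subst hγ hμ
  obtain ⟨p, hp, hpβ, hFp⟩ := exists_F2_neg hω hχ hζ (mul_pos hω hχ)
    (mul_pos (mul_pos hω hχ) hC) hβ
  obtain ⟨x, hx, hpx, hxβ⟩ := (((hasDerivAt_eta ω χ ζ hC hp).eventually_lt_right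
    (mul_neg_of_pos_of_neg (by positivity) hFp)).and (Ioo_mem_nhdsGT hpβ)).exists
  obtain ⟨y, hy, hpy, hyβ⟩ := (((hasDerivAt_eta ω χ ζ hC hβ).eventually_lt_left
    (mul_pos (by positivity) hpos)).and (Ioo_mem_nhdsLT hpβ)).exists
  rcases le_total (eta ω χ ζ C x) (eta ω χ ζ C y) with h | h
  · exact ⟨p, x, β, hp, hpx, hxβ, lt_min hx (h.trans_lt hy)⟩
  · exact ⟨p, y, β, hp, hpy, hyβ, lt_min (h.trans_lt hx) hy⟩
end
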